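/- Let λ and μ be partitions and let z₁, z₂ be invertible elements of a commutative ring R. Define E_{λ,μ}(z₁,z₂) = Σ_{(i,j)∈μ} z₁^{j−μ_i} z₂^{λ'_j−i+1} + Σ_{(i,j)∈λ} z₁^{λ_i−j+1} z₂^{i−μ'_j}. Then the transposition symmetry holds: E_{λ,μ}(z₁, z₂) = E_{λ',μ'}(z₂, z₁), where λ' and μ' are the conjugate partitions. -/

import Mathlib

/-! Carlsson–Okounkov, "Exts and Vertex Operators": the transposition symmetry `E_{λ,μ}(z₁,z₂) = E_{λ′,μ′}(z₂,z₁)` of the fixed-point character of `𝖤`. -/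

open scoped BigOperators

/-- A partition, given by its (1-indexed) parts `p 1 ≥ p 2 ≥ ⋯ ≥ 0`, with finitely many
nonzero parts.  The value `p 0` is irrelevant. -/
def IsPartition (p : ℕ → ℕ) : Prop :=
  (∀ i j, 1 ≤ i → i ≤ j → p j ≤ p i) ∧ ∃ N, ∀ i, N ≤ i → p i = 0

/-- The Young diagram of `p`: the set of boxes `(i, j)` with `i ≥ 1` and `1 ≤ j ≤ p i`. -/
def diagram (p : ℕ → ℕ) : Set (ℕ × ℕ) :=
  {x | 1 ≤ x.1 ∧ 1 ≤ x.2 ∧ x.2 ≤ p x.1}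

/-- The conjugate partition: `conj p j = #{i ≥ 1 : p i ≥ j}`. -/
noncomputable def conj (p : ℕ → ℕ) (j : ℕ) : ℕ :=
  {i | 1 ≤ i ∧ j ≤ p i}.ncard

/-- The hook-type character sum
`E_{λ,μ}(z₁,z₂) = Σ_{□∈μ} z₁^{-a_μ(□)} z₂^{l_λ(□)+1} + Σ_{□∈λ} z₁^{a_λ(□)+1} z₂^{-l_μ(□)}`,
i.e. `Σ_{(i,j)∈μ} z₁^{j−μ_i} z₂^{λ'_j−i+1} + Σ_{(i,j)∈λ} z₁^{λ_i−j+1} z₂^{i−μ'_j}`. -/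
noncomputable def hookSum {R : Type*} [CommRing R] (lam mu : ℕ → ℕ) (z₁ z₂ : Rˣ) : R :=
  (∑ᶠ x ∈ diagram mu,
      ((z₁ ^ ((x.2 : ℤ) - (mu x.1 : ℤ)) : Rˣ) : R) *
        ((z₂ ^ ((conj lam x.2 : ℤ) - (x.1 : ℤ) + 1) : Rˣ) : R))
    + ∑ᶠ x ∈ diagram lam,
        ((z₁ ^ ((lam x.1 : ℤ) - (x.2 : ℤ) + 1) : Rˣ) : R) *
          ((z₂ ^ ((x.1 : ℤ) - (conj mu x.2 : ℤ)) : Rˣ) : R)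

open Finset in
/-- A geometric sum, written without division. -/
lemma pow_succ_eq_add_geom {R : Type*} [CommRing R] (x : R) (n : ℕ) :
    x ^ n * x = x + (x - 1) * ∑ k ∈ Icc 1 n, x ^ k := by
  induction n with
  | zero => simp
  | succ n ih =>
    rw [sum_Icc_succ_top (by omega)]
    linear_combination ih

open Finset in
/-- A geometric sum in the inverse `y` of `x`. -/
lemma inv_pow_eq_add_geom {R : Type*} [CommRing R] {x y : R} (h : x * y = 1) (n : ℕ) :
    y ^ n = 1 + (1 - x) * ∑ k ∈ Icc 1 n, y ^ k := by
  induction n with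
  | zero => simp
  | succ n ih =>
    rw [sum_Icc_succ_top (by omega)]
    linear_combination ih + y ^ n * h

open Finset in
/-- Reversing the order of summation in a geometric sum. -/
lemma sum_pow_mul_inv_pow {R : Type*} [CommRing R] {x y : R} (h : x * y = 1) (n : ℕ) :
    ∑ j ∈ Icc 1 n, x ^ j * y ^ n = x * ∑ j ∈ Icc 1 n, y ^ j := by
  rw [← sum_mul]
  induction n with
  | zero => simp
  | succ n ih =>
    have hn : x ^ n * y ^ n = 1 := by rw [← mul_pow, h, one_pow]
    rw [sum_Icc_succ_top (by omega), sum_Icc_succ_top (by omega)]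
    linear_combination y * ih + x * y * hn + (∑ j ∈ Icc 1 n, y ^ j + 1 - y ^ n) * h
      - inv_pow_eq_add_geom h n

open Finset in
/-- The one-variable identity underlying the symmetric form of the character. -/
lemma sum_min_sub_sum_min {R : Type*} [CommRing R] {x y : R} (h : x * y = 1) (a b : ℕ) :
    ∑ j ∈ Icc 1 (min a b), x ^ j * y ^ b - ∑ j ∈ Icc 1 (min a b), x ^ a * y ^ j * x =
      (1 - x) * ((∑ l ∈ Icc 1 a, x ^ l) * ∑ j ∈ Icc 1 b, y ^ j) := by
  rcases le_total a b with hab | hab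
  · rw [min_eq_left hab, ← sum_mul, ← sum_mul, ← mul_sum]
    have h₁ := sum_pow_mul_inv_pow (mul_comm x y ▸ h) a
    rw [← sum_mul] at h₁
    linear_combination (∑ l ∈ Icc 1 a, x ^ l) * inv_pow_eq_add_geom h b - x * h₁
      - (∑ l ∈ Icc 1 a, x ^ l) * h
  · rw [min_eq_right hab, sum_pow_mul_inv_pow h, ← sum_mul, ← mul_sum]
    linear_combination -(∑ j ∈ Icc 1 b, y ^ j) * pow_succ_eq_add_geom x a

/-- `N` bounds both coordinates of every box of `p`. -/
def BoundsDiagram (p : ℕ → ℕ) (N : ℕ) : Prop :=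
  ∀ i j, 1 ≤ i → 1 ≤ j → j ≤ p i → i ≤ N ∧ j ≤ N

lemma IsPartition.exists_bound {p : ℕ → ℕ} (hp : IsPartition p) :
    ∃ N, ∀ M, N ≤ M → BoundsDiagram p M := by
  obtain ⟨N, hN⟩ := hp.2
  refine ⟨N + p 1, fun M hM i j hi hj hij => ?_⟩
  have h₁ := hp.1 1 i le_rfl hi
  have h₂ : i < N := by
    by_contra! hc
    have := hN i hc
    omega
  omega

lemma IsPartition.le_conj_iff {p : ℕ → ℕ} (hp : IsPartition p) {i j : ℕ} (hi : 1 ≤ i)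
    (hj : 1 ≤ j) : i ≤ conj p j ↔ j ≤ p i := by
  obtain ⟨N, hN⟩ := hp.exists_bound
  have hfin : {k | 1 ≤ k ∧ j ≤ p k}.Finite :=
    (Set.finite_Iic N).subset fun k hk => (hN N le_rfl k j hk.1 hj hk.2).1
  constructor
  · intro h
    by_contra! hc
    have hsub : {k | 1 ≤ k ∧ j ≤ p k} ⊆ (Finset.Icc 1 (i - 1) : Finset ℕ) := by
      intro k hk
      have : k < i := by
        by_contra! hik
        have := hp.1 i k hi hik
        have := hk.2
        omega
      have := hk.1
      simp only [Finset.coe_Icc, Set.mem_Icc]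
      omega
    have := Set.ncard_le_ncard hsub (Finset.finite_toSet _)
    rw [Set.ncard_coe_finset, Nat.card_Icc] at this
    unfold conj at h
    omega
  · intro h
    have hsub : ((Finset.Icc 1 i : Finset ℕ) : Set ℕ) ⊆ {k | 1 ≤ k ∧ j ≤ p k} := by
      intro k hk
      simp only [Finset.coe_Icc, Set.mem_Icc] at hk
      exact ⟨hk.1, h.trans (hp.1 k i hk.1 hk.2)⟩
    have := Set.ncard_le_ncard hsub hfin
    rwa [Set.ncard_coe_finset, Nat.card_Icc, Nat.add_sub_cancel] at this

lemma IsPartition.conj {p : ℕ → ℕ} (hp : IsPartition p) : IsPartition (conj p) := by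
  constructor
  · intro i j hi hij
    rcases Nat.eq_zero_or_pos (_root_.conj p j) with h | h
    · omega
    · exact (hp.le_conj_iff h hi).2
        (hij.trans ((hp.le_conj_iff h (hi.trans hij)).1 le_rfl))
  · obtain ⟨N, hN⟩ := hp.exists_bound
    refine ⟨N + 1, fun j hj => ?_⟩
    by_contra h
    have h := Nat.pos_of_ne_zero h
    have := hN N le_rfl _ j h (by omega) ((hp.le_conj_iff h (by omega)).1 le_rfl)
    omega

lemma IsPartition.mem_diagram_conj {p : ℕ → ℕ} (hp : IsPartition p) (x : ℕ × ℕ) :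
    x ∈ diagram (_root_.conj p) ↔ x.swap ∈ diagram p := by
  constructor
  · rintro ⟨h₁, h₂, h₃⟩
    exact ⟨h₂, h₁, (hp.le_conj_iff h₂ h₁).1 h₃⟩
  · rintro ⟨h₁, h₂, h₃⟩
    exact ⟨h₂, h₁, (hp.le_conj_iff h₁ h₂).2 h₃⟩

/-- The generating function `Σ_{(i,j)∈p} x^j y^i` of the boxes of a diagram. -/
noncomputable def boxSum {R : Type*} [CommRing R] (p : ℕ → ℕ) (x y : R) : R :=
  ∑ᶠ b ∈ diagram p, x ^ b.2 * y ^ b.1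

lemma boxSum_conj {R : Type*} [CommRing R] {p : ℕ → ℕ} (hp : IsPartition p) (x y : R) :
    boxSum (conj p) x y = boxSum p y x := by
  refine finsum_mem_eq_of_bijOn Prod.swap ⟨?_, Prod.swap_injective.injOn, ?_⟩ ?_
  · exact fun b hb => (hp.mem_diagram_conj b).1 hb
  · exact fun b hb => ⟨b.swap, (hp.mem_diagram_conj _).2 (by simpa using hb), b.swap_swap⟩
  · exact fun b _ => mul_comm _ _

open Finset in
lemma finsum_mem_diagram {R : Type*} [CommRing R] {p : ℕ → ℕ} {N : ℕ}
    (hN : BoundsDiagram p N) (f : ℕ × ℕ → R) :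
    ∑ᶠ x ∈ diagram p, f x = ∑ i ∈ Icc 1 N, ∑ j ∈ Icc 1 (p i), f (i, j) := by
  have h : diagram p = ((Icc 1 N).sigma fun i => Icc 1 (p i)).map
      (Equiv.sigmaEquivProd ℕ ℕ).toEmbedding := by
    ext ⟨i, j⟩
    simp only [diagram, Set.mem_ofPred_eq, mem_coe, mem_map_equiv, mem_sigma, mem_Icc,
      Equiv.sigmaEquivProd_symm_apply]
    constructor
    · rintro ⟨h₁, h₂, h₃⟩
      exact ⟨⟨h₁, (hN i j h₁ h₂ h₃).1⟩, h₂, h₃⟩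
    · rintro ⟨⟨h₁, -⟩, h₂, h₃⟩
      exact ⟨h₁, h₂, h₃⟩
  rw [h, finsum_mem_coe_finset, sum_map, sum_sigma]
  rfl

open Finset in
lemma sum_Icc_conj {R : Type*} [CommRing R] {p : ℕ → ℕ} (hp : IsPartition p) {N : ℕ}
    (hN : BoundsDiagram p N) {j : ℕ} (hj : 1 ≤ j) (f : ℕ → R) :
    ∑ k ∈ Icc 1 (conj p j), f k = ∑ k ∈ Icc 1 N, if j ≤ p k then f k else 0 := by
  rw [← sum_filter]
  congr 1
  ext k
  simp only [mem_Icc, mem_filter]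
  constructor
  · rintro ⟨h₁, h₂⟩
    have h₃ := (hp.le_conj_iff h₁ hj).1 h₂
    exact ⟨⟨h₁, (hN k j h₁ hj h₃).1⟩, h₃⟩
  · rintro ⟨⟨h₁, -⟩, h₃⟩
    exact ⟨h₁, (hp.le_conj_iff h₁ hj).2 h₃⟩

open Finset in
/-- Expanding a sum over a row against the columns of another partition. -/
lemma sum_row_mul_sum_column {R : Type*} [CommRing R] {p : ℕ → ℕ} (hp : IsPartition p)
    {N : ℕ} (hN : BoundsDiagram p N) (n : ℕ) (f g : ℕ → R) :
    ∑ j ∈ Icc 1 n, f j * ∑ k ∈ Icc 1 (conj p j), g k =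
      ∑ k ∈ Icc 1 N, g k * ∑ j ∈ Icc 1 (min (p k) n), f j := by
  have h : ∀ j ∈ Icc 1 n, f j * ∑ k ∈ Icc 1 (conj p j), g k =
      ∑ k ∈ Icc 1 N, if j ≤ p k then g k * f j else 0 := by
    intro j hj
    rw [sum_Icc_conj hp hN (mem_Icc.1 hj).1, mul_sum]
    refine sum_congr rfl fun k _ => ?_
    split_ifs <;> ring
  rw [sum_congr rfl h, sum_comm]
  refine sum_congr rfl fun k _ => ?_
  rw [mul_sum, ← sum_filter]
  congr 1
  ext j
  simp only [mem_Icc, mem_filter]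
  omega

open Finset in
/-- The character in a form which is visibly symmetric under transposition. -/
lemma hookSum_eq_boxSum {R : Type*} [CommRing R] {lam mu : ℕ → ℕ}
    (hlam : IsPartition lam) (hmu : IsPartition mu) (z₁ z₂ : Rˣ) :
    hookSum lam mu z₁ z₂ =
      boxSum lam (z₁ : R) z₂ + z₁ * z₂ * boxSum mu (↑z₁⁻¹ : R) ↑z₂⁻¹
        - (1 - z₁) * (1 - z₂) * (boxSum lam (z₁ : R) z₂ * boxSum mu (↑z₁⁻¹ : R) ↑z₂⁻¹) := by
  obtain ⟨N₁, hN₁⟩ := hlam.exists_bound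
  obtain ⟨N₂, hN₂⟩ := hmu.exists_bound
  have hl : BoundsDiagram lam (max N₁ N₂) := hN₁ _ (le_max_left _ _)
  have hm : BoundsDiagram mu (max N₁ N₂) := hN₂ _ (le_max_right _ _)
  generalize max N₁ N₂ = N at hl hm
  unfold hookSum boxSum
  rw [finsum_mem_diagram hm, finsum_mem_diagram hl, finsum_mem_diagram hm,
    finsum_mem_diagram hl]
  simp only [zpow_add, zpow_sub, zpow_natCast, zpow_one, ← inv_pow, Units.val_mul,
    Units.val_pow_eq_pow_val]
  have hx : (z₁ : R) * ↑z₁⁻¹ = 1 := z₁.mul_inv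
  have hy : (z₂ : R) * ↑z₂⁻¹ = 1 := z₂.mul_inv
  generalize (z₁ : R) = x at *
  generalize (z₂ : R) = y at *
  generalize (↑z₁⁻¹ : R) = x' at *
  generalize (↑z₂⁻¹ : R) = y' at *
  have h₁ : ∀ i, ∑ j ∈ Icc 1 (mu i), x ^ j * x' ^ mu i * (y ^ conj lam j * y' ^ i * y) =
      x * y * (∑ j ∈ Icc 1 (mu i), x' ^ j * y' ^ i) + (y - 1) * ∑ k ∈ Icc 1 N,
        y ^ k * y' ^ i * ∑ j ∈ Icc 1 (min (lam k) (mu i)), x ^ j * x' ^ mu i := by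
    intro i
    have := sum_row_mul_sum_column hlam hl (mu i) (fun j => x ^ j * x' ^ mu i)
      (fun k => y ^ k * y' ^ i)
    rw [← this, ← sum_mul, mul_sum]
    have hr := sum_pow_mul_inv_pow hx (mu i)
    have : x * y * ((∑ j ∈ Icc 1 (mu i), x' ^ j) * y' ^ i) =
        ∑ j ∈ Icc 1 (mu i), x ^ j * x' ^ mu i * (y * y' ^ i) := by
      rw [← sum_mul, hr]
      ring
    rw [this, ← sum_add_distrib]
    refine sum_congr rfl fun j _ => ?_
    rw [← sum_mul]
    linear_combination x ^ j * x' ^ mu i * y' ^ i * pow_succ_eq_add_geom y (conj lam j)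
  have h₂ : ∀ k, ∑ j ∈ Icc 1 (lam k), x ^ lam k * x' ^ j * x * (y ^ k * y' ^ conj mu j) =
      (∑ j ∈ Icc 1 (lam k), x ^ j * y ^ k) - (y - 1) * ∑ i ∈ Icc 1 N,
        y ^ k * y' ^ i * ∑ j ∈ Icc 1 (min (lam k) (mu i)), x ^ lam k * x' ^ j * x := by
    intro k
    have := sum_row_mul_sum_column hmu hm (lam k) (fun j => x ^ lam k * x' ^ j * x)
      (fun i => y ^ k * y' ^ i)
    simp only [min_comm (lam k)]
    rw [← this, ← sum_mul, mul_sum]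
    have hr := sum_pow_mul_inv_pow (mul_comm x x' ▸ hx) (lam k)
    rw [← sum_mul] at hr
    have : (∑ j ∈ Icc 1 (lam k), x ^ j) * y ^ k =
        ∑ j ∈ Icc 1 (lam k), x ^ lam k * x' ^ j * x * y ^ k := by
      rw [← sum_mul, ← sum_mul, ← mul_sum]
      linear_combination -x * y ^ k * hr - (∑ j ∈ Icc 1 (lam k), x ^ j) * y ^ k * hx
    rw [this, ← sum_sub_distrib]
    refine sum_congr rfl fun j _ => ?_
    rw [← mul_sum]
    linear_combination x ^ lam k * x' ^ j * x * y ^ k * inv_pow_eq_add_geom hy (conj mu j)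
  have h₃ : ∑ i ∈ Icc 1 N, ∑ k ∈ Icc 1 N,
        y ^ k * y' ^ i * ∑ j ∈ Icc 1 (min (lam k) (mu i)), x ^ j * x' ^ mu i
      - ∑ k ∈ Icc 1 N, ∑ i ∈ Icc 1 N,
        y ^ k * y' ^ i * ∑ j ∈ Icc 1 (min (lam k) (mu i)), x ^ lam k * x' ^ j * x =
      (1 - x) * ((∑ k ∈ Icc 1 N, ∑ l ∈ Icc 1 (lam k), x ^ l * y ^ k) *
        ∑ i ∈ Icc 1 N, ∑ j ∈ Icc 1 (mu i), x' ^ j * y' ^ i) := by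
    rw [sum_comm, ← sum_sub_distrib, sum_mul_sum, mul_sum]
    refine sum_congr rfl fun k _ => ?_
    rw [← sum_sub_distrib, mul_sum]
    refine sum_congr rfl fun i _ => ?_
    have hs := sum_min_sub_sum_min hx (lam k) (mu i)
    simp only [← sum_mul] at hs ⊢
    linear_combination y ^ k * y' ^ i * hs
  rw [sum_congr rfl fun i _ => h₁ i, sum_congr rfl fun k _ => h₂ k, sum_add_distrib,
    sum_sub_distrib, ← mul_sum, ← mul_sum, ← mul_sum]
  linear_combination (y - 1) * h₃

/-- Transposition symmetry: `E_{λ,μ}(z₁, z₂) = E_{λ',μ'}(z₂, z₁)`, where `λ'` and `μ'`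
are the conjugate partitions. -/
theorem hookSum_transpose {R : Type*} [CommRing R] (lam mu : ℕ → ℕ)
    (hlam : IsPartition lam) (hmu : IsPartition mu) (z₁ z₂ : Rˣ) :
    hookSum lam mu z₁ z₂ = hookSum (conj lam) (conj mu) z₂ z₁ := by
  rw [hookSum_eq_boxSum hlam hmu, hookSum_eq_boxSum hlam.conj hmu.conj,
    boxSum_conj hlam, boxSum_conj hmu]
  ring
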